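/- (Proposition 3.2) Let (S_α)_{α ∈ ℕ^d} be square-integrable real random variables, and let N be an ℕ^d-valued random variable independent of the family (S_α), with P(N ≥ α) > 0 for all α ∈ ℕ^d. If Σ_{α, β ∈ ℕ^d} ‖ΔS_α‖₂ ‖ΔS_β‖₂ / P(N ≥ α ∨ β) < ∞, then the partial estimators Z̄_n = Σ_{α ∈ I_0^n} ΔS_α · 1_{{N ≥ α}} / P(N ≥ α) form a Cauchy sequence in L² and hence converge in L² to a square-integrable random variable Z̄, whose second moment is E[Z̄²] = Σ_{α, β ∈ ℕ^d} E[ΔS_α ΔS_β] · P(N ≥ α ∨ β) / (P(N ≥ α) P(N ≥ β)), the series converging absolutely. -/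

import Mathlib

open MeasureTheory ProbabilityTheory Filter

/-- The `i`-th difference operator: `(Δ_i S)_α = S_α − S_{α−e_i}` if `α_i > 0`,
and `(Δ_i S)_α = S_α` if `α_i = 0`. -/
def diffOp {d : ℕ} {V : Type*} [AddCommGroup V] [Module ℝ V]
    (i : Fin d) (S : (Fin d → ℕ) → V) : (Fin d → ℕ) → V :=
  fun α => if α i = 0 then S α else S α - S (Function.update α i (α i - 1))

/-- The mixed difference operator `Δ = Δ_1 ∘ ⋯ ∘ Δ_d`. -/
def mixedDiff {d : ℕ} {V : Type*} [AddCommGroup V] [Module ℝ V]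
    (S : (Fin d → ℕ) → V) : (Fin d → ℕ) → V :=
  (List.finRange d).foldr (fun i T => diffOp i T) S

/-- The partial coupled-sum estimator
`Z̄_n = Σ_{α ∈ I_0^n} ΔS_α · 1_{N ≥ α} / P(N ≥ α)`. -/
noncomputable def partialEstimator {d : ℕ}
    {Ω : Type*} [MeasureSpace Ω]
    (S : (Fin d → ℕ) → Ω → ℝ) (N : Ω → (Fin d → ℕ)) (n : ℕ) (ω : Ω) : ℝ :=
  ∑ α ∈ Finset.Iic ((fun _ => n) : Fin d → ℕ),
    mixedDiff (fun β => S β ω) α * Set.indicator {ω' | α ≤ N ω'} 1 ω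
      / (ℙ {ω' | α ≤ N ω'}).toReal

/-- A family whose Gram series converges absolutely is summable, and the squared norm of its sum
is the sum of the Gram series. -/
theorem summable_of_summable_inner {ι H : Type*} [NormedAddCommGroup H] [InnerProductSpace ℝ H]
    [CompleteSpace H] {F : ι → H} (h : Summable fun p : ι × ι => inner ℝ (F p.1) (F p.2)) :
    Summable F ∧ ‖∑' i, F i‖ ^ 2 = ∑' p : ι × ι, inner ℝ (F p.1) (F p.2) := by
  classical
  have key (s : Finset ι) :
      ‖∑ i ∈ s, F i‖ ^ 2 = ∑ p ∈ s ×ˢ s, inner ℝ (F p.1) (F p.2) := by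
    rw [← real_inner_self_eq_norm_sq, sum_inner, Finset.sum_product]
    simp_rw [inner_sum]
  have hF : Summable F := by
    rw [summable_iff_vanishing_norm]
    intro ε hε
    obtain ⟨s, hs⟩ := summable_iff_vanishing_norm.1 h (ε ^ 2) (by positivity)
    refine ⟨s.image Prod.fst, fun t ht => ?_⟩
    have hts : Disjoint (t ×ˢ t) s := by
      rw [Finset.disjoint_left] at ht ⊢
      exact fun p hp hps => ht (Finset.mem_product.1 hp).1 (Finset.mem_image_of_mem _ hps)
    have h2 := (le_abs_self _).trans_lt (hs _ hts)
    rw [← key] at h2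
    exact lt_of_pow_lt_pow_left₀ 2 hε.le h2
  refine ⟨hF, tendsto_nhds_unique ((hF.hasSum.norm).pow 2) ?_⟩
  simp_rw [key]
  refine h.hasSum.comp (tendsto_atTop_finset_of_monotone
    (fun s t hst => Finset.product_subset_product hst hst) fun p => ⟨{p.1, p.2}, ?_⟩)
  simp [Finset.mem_product]

theorem measurable_mixedDiff {d : ℕ} (α : Fin d → ℕ) :
    Measurable fun x : (Fin d → ℕ) → ℝ => mixedDiff x α := by
  unfold mixedDiff
  induction List.finRange d generalizing α with
  | nil => exact measurable_pi_apply α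
  | cons i l ih =>
    simp only [List.foldr_cons, diffOp]
    split_ifs
    · exact ih α
    · exact (ih α).sub (ih _)

theorem memLp_mixedDiff {d : ℕ} {Ω : Type*} [MeasurableSpace Ω] {μ : Measure Ω} {q : ENNReal}
    {S : (Fin d → ℕ) → Ω → ℝ} (hS : ∀ α, MemLp (S α) q μ) (α : Fin d → ℕ) :
    MemLp (fun ω => mixedDiff (fun γ => S γ ω) α) q μ := by
  unfold mixedDiff
  induction List.finRange d generalizing α with
  | nil => exact hS α
  | cons i l ih =>
    simp only [List.foldr_cons, diffOp]
    split_ifs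
    · exact ih α
    · exact (ih α).sub (ih _)

/-- Cauchy-Schwarz for the mixed moment of two square-integrable functions. -/
theorem abs_integral_mul_le_eLpNorm_two {Ω : Type*} [MeasurableSpace Ω] {μ : Measure Ω}
    {f g : Ω → ℝ} (hf : MemLp f 2 μ) (hg : MemLp g 2 μ) :
    |∫ ω, f ω * g ω ∂μ| ≤ (eLpNorm f 2 μ).toReal * (eLpNorm g 2 μ).toReal := by
  have h := abs_real_inner_le_norm (hf.toLp f) (hg.toLp g)
  rw [L2.inner_def, Lp.norm_toLp, Lp.norm_toLp] at h
  convert h using 2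
  refine integral_congr_ae ?_
  filter_upwards [hf.coeFn_toLp, hg.coeFn_toLp] with ω h1 h2
  simp [h1, h2, mul_comm]

/-- Proposition 3.2: if
`Σ_{α,β} ‖ΔS_α‖₂ ‖ΔS_β‖₂ / P(N ≥ α ∨ β) < ∞`, then the partial estimators `Z̄_n`
form a Cauchy sequence in L², converge in L² to a square-integrable `Z̄`, and
`E[Z̄²] = Σ_{α,β} E[ΔS_α ΔS_β] P(N ≥ α ∨ β)/(P(N ≥ α) P(N ≥ β))`,
the series converging absolutely. -/
theorem secondMoment_estimator {d : ℕ} (hd : 1 ≤ d)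
    {Ω : Type*} [MeasureSpace Ω] [IsProbabilityMeasure (ℙ : Measure Ω)]
    (S : (Fin d → ℕ) → Ω → ℝ) (hS : ∀ α, MemLp (S α) 2 ℙ)
    (N : Ω → (Fin d → ℕ)) (hN : Measurable N)
    (hind : IndepFun N (fun ω => fun α => S α ω) ℙ)
    (hpos : ∀ α : Fin d → ℕ, 0 < ℙ {ω | α ≤ N ω})
    (hsum : Summable (fun p : (Fin d → ℕ) × (Fin d → ℕ) =>
        (eLpNorm (fun ω => mixedDiff (fun γ => S γ ω) p.1) 2 ℙ).toReal
          * (eLpNorm (fun ω => mixedDiff (fun γ => S γ ω) p.2) 2 ℙ).toReal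
          / (ℙ {ω | p.1 ⊔ p.2 ≤ N ω}).toReal)) :
    (∀ ε > (0 : ℝ), ∃ k : ℕ, ∀ m ≥ k, ∀ n ≥ k,
        eLpNorm (fun ω => partialEstimator S N n ω - partialEstimator S N m ω) 2 ℙ
          < ENNReal.ofReal ε) ∧
    ∃ Z : Ω → ℝ, MemLp Z 2 ℙ ∧
      Tendsto (fun n : ℕ => eLpNorm (fun ω => partialEstimator S N n ω - Z ω) 2 ℙ)
        atTop (nhds 0) ∧
      Summable (fun p : (Fin d → ℕ) × (Fin d → ℕ) =>
        |(∫ ω, mixedDiff (fun γ => S γ ω) p.1 * mixedDiff (fun γ => S γ ω) p.2 ∂ℙ)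
          * (ℙ {ω | p.1 ⊔ p.2 ≤ N ω}).toReal
          / ((ℙ {ω | p.1 ≤ N ω}).toReal * (ℙ {ω | p.2 ≤ N ω}).toReal)|) ∧
      (∫ ω, (Z ω) ^ 2 ∂ℙ)
        = ∑' p : (Fin d → ℕ) × (Fin d → ℕ),
            (∫ ω, mixedDiff (fun γ => S γ ω) p.1 * mixedDiff (fun γ => S γ ω) p.2 ∂ℙ)
              * (ℙ {ω | p.1 ⊔ p.2 ≤ N ω}).toReal
              / ((ℙ {ω | p.1 ≤ N ω}).toReal * (ℙ {ω | p.2 ≤ N ω}).toReal) := by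
  have hp0 (α : Fin d → ℕ) : 0 < (ℙ {ω | α ≤ N ω}).toReal :=
    ENNReal.toReal_pos (hpos α).ne' (measure_ne_top _ _)
  have hms (α : Fin d → ℕ) : MeasurableSet {ω | α ≤ N ω} :=
    hN (Set.to_countable (Set.Ici α)).measurableSet
  have hmono {α β : Fin d → ℕ} (h : α ≤ β) :
      (ℙ {ω | β ≤ N ω}).toReal ≤ (ℙ {ω | α ≤ N ω}).toReal :=
    ENNReal.toReal_mono (measure_ne_top _ _) (measure_mono fun ω hω => h.trans hω)
  have hD := memLp_mixedDiff hS
  let X (α : Fin d → ℕ) (ω : Ω) : ℝ :=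
    mixedDiff (fun β => S β ω) α * Set.indicator {ω' | α ≤ N ω'} 1 ω
      / (ℙ {ω' | α ≤ N ω'}).toReal
  have hX (α : Fin d → ℕ) : MemLp (X α) 2 ℙ := by
    have := ((hD α).indicator (hms α)).mul_const (ℙ {ω' | α ≤ N ω'}).toReal⁻¹
    convert this using 2 with ω
    by_cases h : α ≤ N ω <;> simp [X, Set.indicator, h, div_eq_mul_inv]
  let F (α : Fin d → ℕ) : Lp ℝ 2 (ℙ : Measure Ω) := (hX α).toLp (X α)
  have hinner (p : (Fin d → ℕ) × (Fin d → ℕ)) : inner ℝ (F p.1) (F p.2) =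
      (∫ ω, mixedDiff (fun γ => S γ ω) p.1 * mixedDiff (fun γ => S γ ω) p.2 ∂ℙ)
        * (ℙ {ω | p.1 ⊔ p.2 ≤ N ω}).toReal
        / ((ℙ {ω | p.1 ≤ N ω}).toReal * (ℙ {ω | p.2 ≤ N ω}).toReal) := by
    have hm : Measurable (Set.indicator (Set.Ici (p.1 ⊔ p.2)) (1 : (Fin d → ℕ) → ℝ)) :=
      measurable_one.indicator (Set.to_countable _).measurableSet
    have hi := hind.symm.comp
      ((measurable_mixedDiff p.1).mul (measurable_mixedDiff p.2)) hm
    have hint := hi.integral_mul_eq_mul_integral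
      ((hD p.1).aestronglyMeasurable.mul (hD p.2).aestronglyMeasurable)
      (hm.comp hN).aestronglyMeasurable
    have hprob : ∫ ω, (Set.indicator (Set.Ici (p.1 ⊔ p.2)) (1 : (Fin d → ℕ) → ℝ) ∘ N) ω ∂ℙ
        = (ℙ {ω | p.1 ⊔ p.2 ≤ N ω}).toReal :=
      integral_indicator_one (hms (p.1 ⊔ p.2))
    rw [hprob] at hint
    rw [show (∫ ω, mixedDiff (fun γ => S γ ω) p.1 * mixedDiff (fun γ => S γ ω) p.2 ∂ℙ)
        * (ℙ {ω | p.1 ⊔ p.2 ≤ N ω}).toReal = _ from hint.symm, L2.inner_def, ← integral_div]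
    refine integral_congr_ae ?_
    filter_upwards [(hX p.1).coeFn_toLp, (hX p.2).coeFn_toLp] with ω h1 h2
    simp only [F, h1, h2, X]
    by_cases ha : p.1 ≤ N ω <;> by_cases hb : p.2 ≤ N ω <;>
      simp [Set.indicator, ha, hb]
    field_simp
  have hbound (p : (Fin d → ℕ) × (Fin d → ℕ)) : |inner ℝ (F p.1) (F p.2)| ≤
      (eLpNorm (fun ω => mixedDiff (fun γ => S γ ω) p.1) 2 ℙ).toReal
        * (eLpNorm (fun ω => mixedDiff (fun γ => S γ ω) p.2) 2 ℙ).toReal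
        / (ℙ {ω | p.1 ⊔ p.2 ≤ N ω}).toReal := by
    have h1 := hmono (le_sup_left : p.1 ≤ p.1 ⊔ p.2)
    have h2 := hmono (le_sup_right : p.2 ≤ p.1 ⊔ p.2)
    have ha := hp0 p.1
    have hb := hp0 p.2
    have hc := hp0 (p.1 ⊔ p.2)
    rw [hinner, abs_div, abs_mul, abs_of_pos hc, abs_of_pos (mul_pos ha hb),
      div_le_div_iff₀ (mul_pos ha hb) hc, mul_assoc]
    exact mul_le_mul (abs_integral_mul_le_eLpNorm_two (hD p.1) (hD p.2))
      (mul_le_mul h1 h2 hc.le ha.le) (by positivity) (by positivity)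
  have habs : Summable fun p : (Fin d → ℕ) × (Fin d → ℕ) => |inner ℝ (F p.1) (F p.2)| :=
    hsum.of_nonneg_of_le (fun _ => abs_nonneg _) hbound
  obtain ⟨hF, hnorm⟩ := summable_of_summable_inner habs.of_abs
  have hpart (n : ℕ) : ⇑(∑ α ∈ Finset.Iic ((fun _ => n) : Fin d → ℕ), F α)
      =ᵐ[ℙ] partialEstimator S N n := by
    have h (α : Fin d → ℕ) := (hX α).coeFn_toLp
    filter_upwards [Lp.coeFn_finsetSum (Finset.Iic ((fun _ => n) : Fin d → ℕ)) F,
      ae_all_iff.2 h] with ω h1 h2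
    rw [h1, Finset.sum_apply]
    exact Finset.sum_congr rfl fun α _ => h2 α
  have hIic : Tendsto (fun n : ℕ => Finset.Iic ((fun _ => n) : Fin d → ℕ)) atTop atTop :=
    tendsto_atTop_finset_of_monotone
      (fun m n hmn => Finset.Iic_subset_Iic.2 fun _ => hmn)
      fun α => ⟨∑ i, α i, Finset.mem_Iic.2 fun i =>
        Finset.single_le_sum (fun _ _ => Nat.zero_le _) (Finset.mem_univ i)⟩
  have hlim : Tendsto (fun n : ℕ =>
      eLpNorm (fun ω => partialEstimator S N n ω - (∑' α, F α : Lp ℝ 2 ℙ) ω) 2 ℙ)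
      atTop (nhds 0) := by
    refine ((Lp.tendsto_Lp_iff_tendsto_eLpNorm' _ _).1 (hF.hasSum.comp hIic)).congr fun n => ?_
    exact eLpNorm_congr_ae ((hpart n).sub EventuallyEq.rfl)
  have hmem (n : ℕ) : MemLp (partialEstimator S N n) 2 ℙ :=
    (memLp_congr_ae (hpart n)).1 (Lp.memLp _)
  have hZ := Lp.memLp (∑' α, F α)
  refine ⟨fun ε hε => ?_, ⇑(∑' α, F α), hZ, hlim, ?_, ?_⟩
  · obtain ⟨k, hk⟩ := eventually_atTop.1 (hlim.eventually_lt_const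
      (show 0 < ENNReal.ofReal (ε / 2) by simpa using hε))
    refine ⟨k, fun m hm n hn => ?_⟩
    have h := eLpNorm_sub_le (μ := ℙ) (p := 2) ((hmem n).sub hZ).aestronglyMeasurable
      ((hmem m).sub hZ).aestronglyMeasurable (by norm_num)
    rw [sub_sub_sub_cancel_right] at h
    refine h.trans_lt ((ENNReal.add_lt_add (hk n hn) (hk m hm)).trans_eq ?_)
    rw [← ENNReal.ofReal_add (by positivity) (by positivity), add_halves]
  · simpa only [hinner] using habs
  · simp_rw [← hinner]
    rw [← hnorm, ← real_inner_self_eq_norm_sq, L2.inner_def]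
    simp [pow_two]
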